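/- arXiv:1912.01649 — 2 statements merged into one kernel-verified Lean document; each statement's English description precedes it below -/
import Mathlib

section
/- Let M = ⟨S, A, P, R, H, ρ₀⟩ be a finite-horizon episodic MDP, let Ŝ ⊆ S be an arbitrary subset, and let M̂ be the corresponding e-stop MDP. Then for every policy π, the expected cumulative reward in the e-stop MDP is at most that in the original MDP: J_{M̂}(π) ≤ J_M(π). -/
open Finset

/-- A finite-horizon episodic MDP `⟨S, A, P, R, H, ρ₀⟩`. -/
structure MDP (S A : Type*) [Fintype S] [Fintype A] where
  P : S → A → S → ℝ
  P_nonneg : ∀ s a s', 0 ≤ P s a s'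
  P_sum : ∀ s a, ∑ s' : S, P s a s' = 1
  R : S → A → S → ℝ
  R_nonneg : ∀ s a s', 0 ≤ R s a s'
  R_le_one : ∀ s a s', R s a s' ≤ 1
  H : ℕ
  H_pos : 0 < H
  ρ0 : S → ℝ
  ρ0_nonneg : ∀ s, 0 ≤ ρ0 s
  ρ0_sum : ∑ s : S, ρ0 s = 1

/-- A (time-dependent, stochastic) policy. -/
structure Policy (S A : Type*) [Fintype A] where
  p : ℕ → S → A → ℝ
  nonneg : ∀ t s a, 0 ≤ p t s a
  sum_one : ∀ t s, ∑ a : A, p t s a = 1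

/-- The time-`t` state distribution `ρ_π^t`. -/
noncomputable def stateDist {S A : Type*} [Fintype S] [Fintype A]
    (P : S → A → S → ℝ) (pol : ℕ → S → A → ℝ) (ρ0 : S → ℝ) : ℕ → S → ℝ
  | 0 => ρ0
  | t + 1 => fun s => ∑ s' : S, ∑ a : A, stateDist P pol ρ0 t s' * pol t s' a * P s' a s

/-- Expected cumulative reward `J = ∑_{t=0}^{H-2} ∑_{s,a,s'} ρ^t(s) π(a|s,t) P(s,a,s') R(s,a,s')`. -/
noncomputable def valueJ {S A : Type*} [Fintype S] [Fintype A]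
    (P : S → A → S → ℝ) (R : S → A → S → ℝ) (H : ℕ) (ρ0 : S → ℝ)
    (pol : ℕ → S → A → ℝ) : ℝ :=
  ∑ t ∈ Finset.range (H - 1), ∑ s : S, ∑ a : A, ∑ s' : S,
    stateDist P pol ρ0 t s * pol t s a * P s a s' * R s a s'

/-- `J_M(π)`. -/
noncomputable def MDP.J {S A : Type*} [Fintype S] [Fintype A]
    (M : MDP S A) (π : Policy S A) : ℝ :=
  valueJ M.P M.R M.H M.ρ0 π.p

/-- State space `Ŝ ∪ {s_term}` of the e-stop MDP; `none` is the absorbing state `s_term`. -/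
abbrev EState (S : Type*) (Shat : Finset S) := Option {s : S // s ∈ Shat}

/-- Transition kernel of the e-stop MDP. -/
noncomputable def estopP {S A : Type*} [Fintype S] [DecidableEq S]
    (P : S → A → S → ℝ) (Shat : Finset S) :
    EState S Shat → A → EState S Shat → ℝ
  | some s, a, some s' => P s.1 a s'.1
  | some s, a, none => ∑ s' ∈ Shatᶜ, P s.1 a s'
  | none, _, some _ => 0
  | none, _, none => 1

/-- Reward of the e-stop MDP: zero on any transition into or out of `s_term`. -/
noncomputable def estopR {S A : Type*} (R : S → A → S → ℝ) (Shat : Finset S) :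
    EState S Shat → A → EState S Shat → ℝ
  | some s, a, some s' => R s.1 a s'.1
  | _, _, _ => 0

/-- Initial distribution of the e-stop MDP. -/
noncomputable def estopρ0 {S : Type*} [Fintype S] [DecidableEq S]
    (ρ0 : S → ℝ) (Shat : Finset S) : EState S Shat → ℝ
  | some s => ρ0 s.1
  | none => ∑ s ∈ Shatᶜ, ρ0 s

/-- The policy induced on the e-stop MDP by restriction (acting uniformly at `s_term`). -/
noncomputable def estopPol {S A : Type*} [Fintype A]
    (pol : ℕ → S → A → ℝ) (Shat : Finset S) :
    ℕ → EState S Shat → A → ℝ :=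
  fun t s a => match s with
    | some s => pol t s.1 a
    | none => (Fintype.card A : ℝ)⁻¹

/-- `J_{M̂}(π)`: expected cumulative reward of (the restriction of) `π` in the e-stop MDP. -/
noncomputable def estopJ {S A : Type*} [Fintype S] [DecidableEq S] [Fintype A]
    (M : MDP S A) (Shat : Finset S) (π : Policy S A) : ℝ :=
  valueJ (estopP M.P Shat) (estopR M.R Shat) M.H (estopρ0 M.ρ0 Shat) (estopPol π.p Shat)

/-- Probability of the trajectory `τ = (τ₀, …, τ_{H-1})` under policy `π` in `M`. -/
noncomputable def trajProb {S A : Type*} [Fintype S] [Fintype A]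
    (M : MDP S A) (π : Policy S A) (τ : Fin M.H → S) : ℝ :=
  M.ρ0 (τ ⟨0, M.H_pos⟩) *
    ∏ t : Fin (M.H - 1), ∑ a : A,
      π.p t.1 (τ ⟨t.1, Nat.lt_of_lt_of_le t.2 (Nat.sub_le _ _)⟩) a *
        M.P (τ ⟨t.1, Nat.lt_of_lt_of_le t.2 (Nat.sub_le _ _)⟩) a
          (τ ⟨t.1 + 1, by have := t.2; omega⟩)

/-- Hitting probability `h(s)`: the probability that `π` visits `s` during an episode. -/
noncomputable def hitProb {S A : Type*} [Fintype S] [DecidableEq S] [Fintype A]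
    (M : MDP S A) (π : Policy S A) (s : S) : ℝ :=
  ∑ τ : Fin M.H → S, trajProb M π τ * (if ∃ t, τ t = s then 1 else 0)

/-- Average state distribution `ρ_π(s) = (1/H) ∑_{t=0}^{H-1} ρ_π^t(s)`. -/
noncomputable def avgDist {S A : Type*} [Fintype S] [Fintype A]
    (M : MDP S A) (π : Policy S A) (s : S) : ℝ :=
  (M.H : ℝ)⁻¹ * ∑ t ∈ Finset.range M.H, stateDist M.P π.p M.ρ0 t s

/-- A sum over the e-stop state space whose terminal term vanishes is at most the corresponding
sum over the original state space. -/
theorem sum_estate_le {S : Type*} [Fintype S] {Shat : Finset S} {f : EState S Shat → ℝ}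
    {g : S → ℝ} (hnone : f none = 0) (hfg : ∀ s : {s : S // s ∈ Shat}, f (some s) ≤ g s.1)
    (hg : ∀ s, 0 ≤ g s) : ∑ s, f s ≤ ∑ s, g s := by
  rw [Fintype.sum_option, hnone, zero_add]
  calc ∑ s, f (some s) ≤ ∑ s : {s : S // s ∈ Shat}, g s.1 := Finset.sum_le_sum fun s _ => hfg s
    _ = ∑ s ∈ Shat, g s := Finset.sum_coe_sort Shat g
    _ ≤ ∑ s, g s := Finset.sum_le_sum_of_subset_of_nonneg (Finset.subset_univ _)
        fun s _ _ => hg s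

theorem stateDist_nonneg {S A : Type*} [Fintype S] [Fintype A]
    {P : S → A → S → ℝ} {pol : ℕ → S → A → ℝ} {ρ0 : S → ℝ} (hP : ∀ s a s', 0 ≤ P s a s')
    (hpol : ∀ t s a, 0 ≤ pol t s a) (hρ0 : ∀ s, 0 ≤ ρ0 s) (t : ℕ) (s : S) :
    0 ≤ stateDist P pol ρ0 t s := by
  induction t generalizing s with
  | zero => exact hρ0 s
  | succ t ih =>
    exact Finset.sum_nonneg fun s' _ => Finset.sum_nonneg fun a _ =>
      mul_nonneg (mul_nonneg (ih s') (hpol t s' a)) (hP s' a s)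

/-- On `Ŝ`, the state distribution of the e-stop MDP is dominated by the original one. -/
theorem stateDist_estop_le {S A : Type*} [Fintype S] [DecidableEq S] [Fintype A]
    {P : S → A → S → ℝ} {pol : ℕ → S → A → ℝ} {ρ0 : S → ℝ} (hP : ∀ s a s', 0 ≤ P s a s')
    (hpol : ∀ t s a, 0 ≤ pol t s a) (hρ0 : ∀ s, 0 ≤ ρ0 s) (Shat : Finset S) (t : ℕ)
    (s : {s : S // s ∈ Shat}) :
    stateDist (estopP P Shat) (estopPol pol Shat) (estopρ0 ρ0 Shat) t (some s) ≤
      stateDist P pol ρ0 t s.1 := by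
  induction t generalizing s with
  | zero => exact le_rfl
  | succ t ih =>
    refine sum_estate_le ?_ (fun s' => Finset.sum_le_sum fun a _ => ?_) fun s' =>
      Finset.sum_nonneg fun a _ =>
        mul_nonneg (mul_nonneg (stateDist_nonneg hP hpol hρ0 t s') (hpol t s' a)) (hP s' a s)
    · simp [estopP]
    · exact mul_le_mul_of_nonneg_right
        (mul_le_mul_of_nonneg_right (ih s') (hpol t s'.1 a)) (hP s'.1 a s.1)

/-- the e-stop MDP only ever loses reward: `J_{M̂}(π) ≤ J_M(π)` for all `π`. -/
theorem estopJ_le_J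
    {S A : Type*} [Fintype S] [DecidableEq S] [Fintype A]
    (M : MDP S A) (Shat : Finset S) (π : Policy S A) :
    estopJ M Shat π ≤ M.J π := by
  have hρ := stateDist_nonneg M.P_nonneg π.nonneg M.ρ0_nonneg
  have hterm (t : ℕ) (s : S) (a : A) (s' : S) :
      0 ≤ stateDist M.P π.p M.ρ0 t s * π.p t s a * M.P s a s' * M.R s a s' :=
    mul_nonneg (mul_nonneg (mul_nonneg (hρ t s) (π.nonneg t s a)) (M.P_nonneg s a s'))
      (M.R_nonneg s a s')
  rw [estopJ, MDP.J, valueJ, valueJ]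
  refine Finset.sum_le_sum fun t _ => sum_estate_le ?_ (fun s => Finset.sum_le_sum fun a _ => ?_)
    fun s => Finset.sum_nonneg fun a _ => Finset.sum_nonneg fun s' _ => hterm t s a s'
  · simp [estopR]
  refine sum_estate_le ?_ (fun s' => ?_) (hterm t s.1 a)
  · simp [estopR]
  · exact mul_le_mul_of_nonneg_right (mul_le_mul_of_nonneg_right (mul_le_mul_of_nonneg_right
      (stateDist_estop_le M.P_nonneg π.nonneg M.ρ0_nonneg Shat t s) (π.nonneg t s.1 a))
      (M.P_nonneg s.1 a s'.1)) (M.R_nonneg s.1 a s'.1)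
end

section
/- Let M = ⟨S, A, P, R, H, ρ₀⟩ be a finite-horizon episodic MDP with expert policy π_e, let Ŝ ⊆ S, and let M̂ be the corresponding e-stop MDP. Then the loss the expert incurs from the e-stop modification is bounded by the total hitting probability of the removed states: J_M(π_e) − J_{M̂}(π_e) ≤ H · Σ_{s ∈ S∖Ŝ} h(s). -/
open Finset

/-- The mass at time `n` of the (sub-)Markov chain with initial mass `ρ` and kernels `K`. -/
noncomputable def chainMass {S : Type*} [Fintype S] (ρ : S → ℝ) (K : ℕ → S → S → ℝ) :
    ℕ → S → ℝ
  | 0 => ρ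
  | n + 1 => fun s => ∑ s', chainMass ρ K n s' * K n s' s

/-- The one-step state transition kernel of `P` under the policy `pol`. -/
noncomputable def policyKernel {S A : Type*} [Fintype A] (P : S → A → S → ℝ)
    (pol : ℕ → S → A → ℝ) (t : ℕ) (s s' : S) : ℝ :=
  ∑ a, pol t s a * P s a s'

theorem stateDist_eq_chainMass {S A : Type*} [Fintype S] [Fintype A] (P : S → A → S → ℝ)
    (pol : ℕ → S → A → ℝ) (ρ : S → ℝ) (n : ℕ) :
    stateDist P pol ρ n = chainMass ρ (policyKernel P pol) n := by
  induction n with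
  | zero => rfl
  | succ n ih =>
    funext s
    simp only [stateDist, chainMass, ih, policyKernel, Finset.mul_sum, mul_assoc]

theorem sum_paths_eq_sum_chainMass {S : Type*} [Fintype S] (ρ : S → ℝ) (K : ℕ → S → S → ℝ)
    (n : ℕ) (F : S → ℝ) :
    ∑ τ : Fin (n + 1) → S,
      ρ (τ 0) * (∏ t : Fin n, K t (τ t.castSucc) (τ t.succ)) * F (τ (Fin.last n)) =
    ∑ s, chainMass ρ K n s * F s := by
  induction n generalizing F with
  | zero =>
    rw [← (Equiv.funUnique (Fin 1) S).symm.sum_comp]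
    simp [chainMass]
  | succ n ih =>
    rw [← (Fin.snocEquiv fun _ : Fin (n + 2) => S).sum_comp, Fintype.sum_prod_type]
    have h (s : S) := ih (fun x => K n x s * F s)
    simp only [chainMass, Finset.sum_mul]
    refine Finset.sum_congr rfl fun s _ => ?_
    simp only [mul_assoc] at h ⊢
    rw [← h s]
    refine Finset.sum_congr rfl fun τ _ => ?_
    have h0 : (Fin.snoc τ s : Fin (n + 2) → S) 0 = τ 0 :=
      Fin.snoc_castSucc (α := fun _ => S) s τ 0
    have hc (i : Fin (n + 1)) : (Fin.snoc τ s : Fin (n + 2) → S) i.castSucc = τ i :=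
      Fin.snoc_castSucc (α := fun _ => S) s τ i
    have hl : (Fin.snoc τ s : Fin (n + 2) → S) (Fin.last (n + 1)) = s :=
      Fin.snoc_last (α := fun _ => S) s τ
    simp only [Fin.snocEquiv_apply, Fin.prod_univ_castSucc, h0, hc, hl, Fin.succ_last,
      ← Fin.castSucc_succ, Fin.val_castSucc, Fin.val_last, mul_assoc]

section Nonneg

variable {S : Type*} [Fintype S] {ρ ρ' : S → ℝ} {K K' : ℕ → S → S → ℝ}

theorem chainMass_nonneg (hρ : ∀ s, 0 ≤ ρ s) (hK : ∀ t s s', 0 ≤ K t s s') (n : ℕ) (s : S) :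
    0 ≤ chainMass ρ K n s := by
  induction n generalizing s with
  | zero => exact hρ s
  | succ n ih => exact Finset.sum_nonneg fun x _ => mul_nonneg (ih x) (hK n x s)

theorem chainMass_mono (hρ : ∀ s, 0 ≤ ρ s) (hK : ∀ t s s', 0 ≤ K t s s')
    (hρρ' : ∀ s, ρ s ≤ ρ' s) (hKK' : ∀ t s s', K t s s' ≤ K' t s s') (n : ℕ) (s : S) :
    chainMass ρ K n s ≤ chainMass ρ' K' n s := by
  induction n generalizing s with
  | zero => exact hρρ' s
  | succ n ih =>
    exact Finset.sum_le_sum fun x _ => mul_le_mul (ih x) (hKK' n x s) (hK n x s)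
      ((chainMass_nonneg hρ hK n x).trans (ih x))

theorem sum_chainMass_of_stochastic (hρ : ∑ s, ρ s = 1) (hK : ∀ t s, ∑ s', K t s s' = 1)
    (n : ℕ) : ∑ s, chainMass ρ K n s = 1 := by
  induction n with
  | zero => exact hρ
  | succ n ih =>
    simp only [chainMass]
    rw [Finset.sum_comm]
    simp only [← Finset.mul_sum, hK, mul_one, ih]

theorem sum_chainMass_antitone (hρ : ∀ s, 0 ≤ ρ s) (hK : ∀ t s s', 0 ≤ K t s s')
    (hK1 : ∀ t s, ∑ s', K t s s' ≤ 1) : Antitone fun n => ∑ s, chainMass ρ K n s := by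
  refine antitone_nat_of_succ_le fun n => ?_
  simp only [chainMass]
  rw [Finset.sum_comm]
  simp only [← Finset.mul_sum]
  exact Finset.sum_le_sum fun s _ =>
    mul_le_of_le_one_right (chainMass_nonneg hρ hK n s) (hK1 n s)

end Nonneg

theorem sum_subtype_eq_sum_of_eq_zero {S : Type*} [Fintype S] (Shat : Finset S)
    {f : S → ℝ} (hf : ∀ s ∉ Shat, f s = 0) :
    ∑ s : {s // s ∈ Shat}, f s = ∑ s, f s := by
  rw [Finset.sum_coe_sort Shat f]
  exact Finset.sum_subset (Finset.subset_univ _) fun s _ hs => hf s hs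

/-- The mass of the trajectories of `M` that stay in `Shat` up to time `n`, by final state. -/
noncomputable def survivalMass {S A : Type*} [Fintype S] [DecidableEq S] [Fintype A]
    (M : MDP S A) (π : Policy S A) (Shat : Finset S) : ℕ → S → ℝ :=
  chainMass (fun s => M.ρ0 s * if s ∈ Shat then 1 else 0)
    (fun t s s' => policyKernel M.P π.p t s s' * if s' ∈ Shat then 1 else 0)

section EStop

variable {S A : Type*} [Fintype S] [Fintype A] (M : MDP S A) (π : Policy S A)

theorem policyKernel_nonneg (t : ℕ) (s s' : S) : 0 ≤ policyKernel M.P π.p t s s' :=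
  Finset.sum_nonneg fun a _ => mul_nonneg (π.nonneg t s a) (M.P_nonneg s a s')

theorem sum_policyKernel (t : ℕ) (s : S) : ∑ s', policyKernel M.P π.p t s s' = 1 := by
  simp only [policyKernel]
  rw [Finset.sum_comm]
  simp only [← Finset.mul_sum, M.P_sum, mul_one, π.sum_one]

theorem trajProb_nonneg (τ : Fin M.H → S) : 0 ≤ trajProb M π τ :=
  mul_nonneg (M.ρ0_nonneg _) (Finset.prod_nonneg fun _ _ => policyKernel_nonneg M π _ _ _)

theorem sum_trajProb : ∑ τ, trajProb M π τ = 1 := by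
  have hρ := M.ρ0_sum
  have hK := sum_policyKernel M π
  obtain ⟨P, hP, hP1, R, hR, hR1, H, hH, ρ0, hρ0, hρ1⟩ := M
  obtain ⟨n, rfl⟩ := Nat.exists_eq_succ_of_ne_zero hH.ne'
  have h := sum_paths_eq_sum_chainMass ρ0 (policyKernel P π.p) n (fun _ => 1)
  simp only [mul_one] at h
  exact h.trans (sum_chainMass_of_stochastic hρ hK n)

variable [DecidableEq S] (Shat : Finset S)

theorem sum_trajProb_survival :
    ∑ τ, trajProb M π τ * (∏ t, if τ t ∈ Shat then 1 else 0) =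
      ∑ s, survivalMass M π Shat (M.H - 1) s := by
  obtain ⟨P, hP, hP1, R, hR, hR1, H, hH, ρ0, hρ0, hρ1⟩ := M
  obtain ⟨n, rfl⟩ := Nat.exists_eq_succ_of_ne_zero hH.ne'
  have h := sum_paths_eq_sum_chainMass (fun s => ρ0 s * if s ∈ Shat then 1 else 0)
    (fun t s s' => policyKernel P π.p t s s' * if s' ∈ Shat then 1 else 0) n (fun _ => 1)
  simp only [mul_one] at h
  refine Eq.trans (Finset.sum_congr rfl fun τ _ => ?_) h
  rw [Finset.prod_mul_distrib, Fin.prod_univ_succ, mul_mul_mul_comm]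
  rfl

theorem survivalMass_nonneg (n : ℕ) (s : S) : 0 ≤ survivalMass M π Shat n s :=
  chainMass_nonneg (fun s => mul_nonneg (M.ρ0_nonneg s) (by split_ifs <;> norm_num))
    (fun t s s' => mul_nonneg (policyKernel_nonneg M π t s s') (by split_ifs <;> norm_num)) n s

theorem survivalMass_le_stateDist (n : ℕ) (s : S) :
    survivalMass M π Shat n s ≤ stateDist M.P π.p M.ρ0 n s := by
  rw [stateDist_eq_chainMass]
  exact chainMass_mono
    (fun s => mul_nonneg (M.ρ0_nonneg s) (by split_ifs <;> norm_num))
    (fun t s s' => mul_nonneg (policyKernel_nonneg M π t s s') (by split_ifs <;> norm_num))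
    (fun s => mul_le_of_le_one_right (M.ρ0_nonneg s) (by split_ifs <;> norm_num))
    (fun t s s' => mul_le_of_le_one_right (policyKernel_nonneg M π t s s')
      (by split_ifs <;> norm_num)) n s

theorem sum_survivalMass_antitone : Antitone fun n => ∑ s, survivalMass M π Shat n s :=
  sum_chainMass_antitone (fun s => mul_nonneg (M.ρ0_nonneg s) (by split_ifs <;> norm_num))
    (fun t s s' => mul_nonneg (policyKernel_nonneg M π t s s') (by split_ifs <;> norm_num))
    (fun t s => (Finset.sum_le_sum fun s' _ => mul_le_of_le_one_right
      (policyKernel_nonneg M π t s s') (by split_ifs <;> norm_num)).trans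
      (sum_policyKernel M π t s).le)

theorem survivalMass_eq_zero {s : S} (hs : s ∉ Shat) (n : ℕ) :
    survivalMass M π Shat n s = 0 := by
  cases n <;> simp [survivalMass, chainMass, hs]

theorem stateDist_estop_some (n : ℕ) (s : {s // s ∈ Shat}) :
    stateDist (estopP M.P Shat) (estopPol π.p Shat) (estopρ0 M.ρ0 Shat) n (some s) =
      survivalMass M π Shat n s := by
  induction n generalizing s with
  | zero => simp [stateDist, survivalMass, chainMass, estopρ0]
  | succ n ih =>
    simp only [stateDist, Fintype.sum_option, ih, estopP, estopPol, mul_zero, Finset.sum_const_zero, zero_add]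
    rw [sum_subtype_eq_sum_of_eq_zero Shat
      (f := fun x => ∑ a, survivalMass M π Shat n x * π.p n x a * M.P x a s)
      fun x hx => by simp [survivalMass_eq_zero M π Shat hx]]
    simp [survivalMass, chainMass, policyKernel, Finset.mul_sum, mul_assoc]

theorem estopJ_eq_sum_survivalMass :
    estopJ M Shat π = ∑ t ∈ Finset.range (M.H - 1), ∑ s, ∑ a, ∑ s',
      survivalMass M π Shat t s * π.p t s a * M.P s a s' *
        ((if s' ∈ Shat then 1 else 0) * M.R s a s') := by
  rw [estopJ, valueJ]
  refine Finset.sum_congr rfl fun t _ => ?_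
  rw [← sum_subtype_eq_sum_of_eq_zero Shat (f := fun s => ∑ a, ∑ s',
    survivalMass M π Shat t s * π.p t s a * M.P s a s' *
      ((if s' ∈ Shat then 1 else 0) * M.R s a s'))
    fun x hx => by simp [survivalMass_eq_zero M π Shat hx], Fintype.sum_option]
  simp only [Fintype.sum_option, stateDist_estop_some, estopP, estopPol, estopR, mul_zero,
    Finset.sum_const_zero, zero_add]
  refine Finset.sum_congr rfl fun s _ => Finset.sum_congr rfl fun a _ => ?_
  rw [← sum_subtype_eq_sum_of_eq_zero Shat (f := fun s' =>
    survivalMass M π Shat t s * π.p t s a * M.P s a s' *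
      ((if s' ∈ Shat then 1 else 0) * M.R s a s')) fun x hx => by simp [hx]]
  exact Finset.sum_congr rfl fun s' _ => by simp

theorem one_sub_sum_survivalMass_le_sum_hitProb :
    1 - ∑ s, survivalMass M π Shat (M.H - 1) s ≤ ∑ s ∈ Shatᶜ, hitProb M π s := by
  rw [← sum_trajProb M π, ← sum_trajProb_survival, ← Finset.sum_sub_distrib]
  simp only [hitProb]
  rw [Finset.sum_comm]
  refine Finset.sum_le_sum fun τ _ => ?_
  rw [← Finset.mul_sum, ← mul_one_sub]
  refine mul_le_mul_of_nonneg_left ?_ (trajProb_nonneg M π τ)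
  have hnn : ∀ s ∈ Shatᶜ, (0 : ℝ) ≤ if ∃ t, τ t = s then 1 else 0 :=
    fun s _ => by split_ifs <;> norm_num
  by_cases hτ : ∀ t, τ t ∈ Shat
  · simp [hτ]
  · push Not at hτ
    obtain ⟨t, ht⟩ := hτ
    rw [Finset.prod_eq_zero (Finset.mem_univ t) (by simp [ht]), sub_zero]
    refine le_trans (by simp) (Finset.single_le_sum hnn (Finset.mem_compl.2 ht))

theorem reward_gap_le_one_sub_sum_survivalMass (t : ℕ) :
    ∑ s, ∑ a, ∑ s', stateDist M.P π.p M.ρ0 t s * π.p t s a * M.P s a s' * M.R s a s' -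
      ∑ s, ∑ a, ∑ s', survivalMass M π Shat t s * π.p t s a * M.P s a s' *
        ((if s' ∈ Shat then 1 else 0) * M.R s a s') ≤
      1 - ∑ s, survivalMass M π Shat (t + 1) s := by
  have h1 : ∑ s, ∑ a, ∑ s', stateDist M.P π.p M.ρ0 t s * π.p t s a * M.P s a s' = 1 := by
    simp only [← Finset.mul_sum, M.P_sum, mul_one, π.sum_one]
    rw [stateDist_eq_chainMass]
    exact sum_chainMass_of_stochastic M.ρ0_sum (sum_policyKernel M π) t
  have h2 : ∑ s, survivalMass M π Shat (t + 1) s =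
      ∑ s, ∑ a, ∑ s', survivalMass M π Shat t s * π.p t s a * M.P s a s' *
        (if s' ∈ Shat then 1 else 0) := by
    simp only [survivalMass, chainMass, policyKernel]
    rw [Finset.sum_comm]
    refine Finset.sum_congr rfl fun s _ => ?_
    rw [Finset.sum_comm]
    simp only [Finset.mul_sum, Finset.sum_mul, mul_assoc]
  rw [h2]
  refine le_of_le_of_eq ?_ (congrArg (· - _) h1)
  simp only [← Finset.sum_sub_distrib]
  refine Finset.sum_le_sum fun s _ => Finset.sum_le_sum fun a _ =>
    Finset.sum_le_sum fun s' _ => ?_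
  rw [← mul_assoc _ _ (M.R s a s'), ← sub_mul]
  refine mul_le_of_le_one_right (sub_nonneg.2 ?_) (M.R_le_one s a s')
  have hp := π.nonneg t s a
  have hP := M.P_nonneg s a s'
  have hq := survivalMass_nonneg M π Shat t s
  calc _ ≤ survivalMass M π Shat t s * π.p t s a * M.P s a s' :=
        mul_le_of_le_one_right (by positivity) (by split_ifs <;> norm_num)
    _ ≤ _ := by
        gcongr
        exact survivalMass_le_stateDist M π Shat t s

end EStop

/-- the expert's loss from the e-stop modification is bounded by `H` times
the total hitting probability of the removed states. -/
theorem expert_loss_bound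
    {S A : Type*} [Fintype S] [DecidableEq S] [Fintype A]
    (M : MDP S A) (πe : Policy S A) (Shat : Finset S) :
    M.J πe - estopJ M Shat πe ≤ (M.H : ℝ) * ∑ s ∈ Shatᶜ, hitProb M πe s := by
  have hhit : 0 ≤ ∑ s ∈ Shatᶜ, hitProb M πe s :=
    Finset.sum_nonneg fun s _ => Finset.sum_nonneg fun τ _ =>
      mul_nonneg (trajProb_nonneg M πe τ) (by split_ifs <;> norm_num)
  rw [estopJ_eq_sum_survivalMass, MDP.J, valueJ, ← Finset.sum_sub_distrib]
  calc _ ≤ ∑ t ∈ Finset.range (M.H - 1), ∑ s ∈ Shatᶜ, hitProb M πe s := by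
        refine Finset.sum_le_sum fun t ht => ?_
        have hanti := sum_survivalMass_antitone M πe Shat
          (Nat.succ_le_of_lt (Finset.mem_range.1 ht))
        exact (reward_gap_le_one_sub_sum_survivalMass M πe Shat t).trans
          ((sub_le_sub_left hanti 1).trans
            (one_sub_sum_survivalMass_le_sum_hitProb M πe Shat))
    _ = ((M.H - 1 : ℕ) : ℝ) * ∑ s ∈ Shatᶜ, hitProb M πe s := by simp
    _ ≤ _ := mul_le_mul_of_nonneg_right (by exact_mod_cast Nat.sub_le _ _) hhit
end
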